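/- arXiv:1305.7218 — 2 statements merged into one kernel-verified Lean document; each statement's English description precedes it below -/
import Mathlib

section
/- Let K be a field of characteristic 0 and let e : RatFunc K ≃ₐ[K] RatFunc K be a K-algebra automorphism with e ∘ e = id and e ≠ id. Set μ = e(X). Then at least one of X·μ and X + μ is not a constant (i.e. does not lie in the image of K in RatFunc K). Define λ = X·μ if X·μ is not constant, and λ = X + μ otherwise. Then e(λ) = λ, the intermediate field K⟮λ⟯ generated by λ over K has index 2 in RatFunc K (i.e. [RatFunc K : K⟮λ⟯] = 2), and K⟮λ⟯ equals the fixed field of the subgroup of automorphisms generated by e. -/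
open IntermediateField in
/-- The degree of a rational function, measured by the index of the field it generates,
is subadditive under multiplication. -/
theorem RatFunc.finrank_adjoin_mul_le {K : Type*} [Field K] (f g : RatFunc K) :
    Module.finrank K⟮f * g⟯ (RatFunc K) ≤
      Module.finrank K⟮f⟯ (RatFunc K) + Module.finrank K⟮g⟯ (RatFunc K) := by
  rcases eq_or_ne (f * g) 0 with h | h
  · rw [finrank_eq_max_natDegree, h]
    simp
  have hnum := Polynomial.natDegree_le_of_dvd (num_mul_dvd f g)
    (mul_ne_zero (num_ne_zero (left_ne_zero_of_mul h)) (num_ne_zero (right_ne_zero_of_mul h)))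
  have hden := Polynomial.natDegree_le_of_dvd (denom_mul_dvd f g)
    (mul_ne_zero (denom_ne_zero f) (denom_ne_zero g))
  have := Polynomial.natDegree_mul_le (p := f.num) (q := g.num)
  have := Polynomial.natDegree_mul_le (p := f.denom) (q := g.denom)
  simp only [finrank_eq_max_natDegree]
  omega

open IntermediateField in
/-- The degree of a rational function, measured by the index of the field it generates,
is subadditive under addition. -/
theorem RatFunc.finrank_adjoin_add_le {K : Type*} [Field K] (f g : RatFunc K) :
    Module.finrank K⟮f + g⟯ (RatFunc K) ≤
      Module.finrank K⟮f⟯ (RatFunc K) + Module.finrank K⟮g⟯ (RatFunc K) := by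
  rcases eq_or_ne (f + g) 0 with h | h
  · rw [finrank_eq_max_natDegree, h]
    simp
  have hden₀ : f.denom * g.denom ≠ 0 := mul_ne_zero (denom_ne_zero f) (denom_ne_zero g)
  have hnum₀ : f.num * g.denom + f.denom * g.num ≠ 0 := by
    intro h₀
    have := num_denom_add f g
    rw [h₀, zero_mul] at this
    exact mul_ne_zero (num_ne_zero h) hden₀ this
  have hdvd : (f + g).num ∣ f.num * g.denom + f.denom * g.num :=
    (isCoprime_num_denom (f + g)).dvd_of_dvd_mul_right ⟨_, (num_denom_add f g).symm⟩
  have hnum := Polynomial.natDegree_le_of_dvd hdvd hnum₀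
  have hden := Polynomial.natDegree_le_of_dvd (denom_add_dvd f g) hden₀
  have := Polynomial.natDegree_add_le (f.num * g.denom) (f.denom * g.num)
  have := Polynomial.natDegree_mul_le (p := f.num) (q := g.denom)
  have := Polynomial.natDegree_mul_le (p := f.denom) (q := g.num)
  have := Polynomial.natDegree_mul_le (p := f.denom) (q := g.denom)
  simp only [finrank_eq_max_natDegree]
  omega

open IntermediateField in
theorem RatFunc.adjoin_algEquiv_X {K : Type*} [Field K] (e : RatFunc K ≃ₐ[K] RatFunc K) :
    K⟮e X⟯ = ⊤ := by
  have h := adjoin_map K {(X : RatFunc K)} (e : RatFunc K →ₐ[K] RatFunc K)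
  rw [adjoin_X, Set.image_singleton, ← AlgHom.fieldRange_eq_map,
    AlgHom.fieldRange_eq_top.mpr e.surjective] at h
  exact h.symm

open IntermediateField in
/-- A nonconstant rational function of degree at most two fixed by a nontrivial automorphism
generates a subfield of index two, namely the fixed field of that automorphism. -/
theorem RatFunc.adjoin_eq_fixedField_of_finrank_le_two {K : Type*} [Field K]
    {e : RatFunc K ≃ₐ[K] RatFunc K} (hne : e ≠ AlgEquiv.refl) {f : RatFunc K}
    (hf : f ∉ Set.range (algebraMap K (RatFunc K))) (hfix : e f = f)
    (hle : Module.finrank K⟮f⟯ (RatFunc K) ≤ 2) :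
    Module.finrank K⟮f⟯ (RatFunc K) = 2 ∧ K⟮f⟯ = fixedField (Subgroup.zpowers e) := by
  have hsub : K⟮f⟯ ≤ fixedField (Subgroup.zpowers e) := by
    rw [adjoin_simple_le_iff, mem_fixedField_iff]
    intro g hg
    have : Subgroup.zpowers e ≤ MulAction.stabilizer _ f := by
      simpa [MulAction.mem_stabilizer_iff] using hfix
    exact this hg
  have htop : fixedField (Subgroup.zpowers e) ≠ ⊤ := fun h ↦ hne <| AlgEquiv.ext fun x ↦
    (mem_fixedField_iff _ x).mp (h ▸ mem_top) e (Subgroup.mem_zpowers e)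
  have hpos : Module.finrank K⟮f⟯ (RatFunc K) ≠ 0 := by
    rw [finrank_eq_max_natDegree, Ne, Nat.max_eq_zero_iff, ← eq_C_iff]
    rintro ⟨c, rfl⟩
    exact hf ⟨c, rfl⟩
  have hmul := relfinrank_mul_finrank_top hsub
  have hone := mt finrank_eq_one_iff_eq_top.mp htop
  have hrel : relfinrank K⟮f⟯ (fixedField (Subgroup.zpowers e)) = 1 := by
    rw [← hmul] at hle hpos
    obtain ⟨ha, hb⟩ := mul_ne_zero_iff.mp hpos
    have hb : 2 ≤ Module.finrank (fixedField (Subgroup.zpowers e)) (RatFunc K) := by omega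
    have := Nat.mul_le_mul_left (relfinrank K⟮f⟯ (fixedField (Subgroup.zpowers e))) hb
    omega
  have heq := hsub.antisymm (relfinrank_eq_one_iff.mp hrel)
  refine ⟨?_, heq⟩
  rw [← heq] at hone
  omega

/-- The sum and the product of `X` with another rational function are not both constant. -/
theorem RatFunc.X_mul_or_X_add_notMem_range {K : Type*} [Field K] (f : RatFunc K) :
    X * f ∉ Set.range (algebraMap K (RatFunc K)) ∨
      X + f ∉ Set.range (algebraMap K (RatFunc K)) := by
  by_contra! h
  obtain ⟨⟨c, hc⟩, ⟨d, hd⟩⟩ := h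
  refine transcendental_X (K := K)
    ⟨Polynomial.X ^ 2 - Polynomial.C d * Polynomial.X + Polynomial.C c, ?_, ?_⟩
  · intro h
    simpa [Polynomial.coeff_X, Polynomial.coeff_C] using congrArg (Polynomial.coeff · 2) h
  · simp only [map_add, map_sub, map_mul, map_pow, Polynomial.aeval_X, Polynomial.aeval_C, hc, hd]
    ring

/-- For an order-2 `K`-automorphism `e` of `RatFunc K` with `μ = e(X)`:
at least one of `X·μ`, `X + μ` is nonconstant; and `λ` (defined as `X·μ` if
that is nonconstant, `X + μ` otherwise) is fixed by `e`, generates an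
intermediate field of index 2, and `K(λ)` is the fixed field of `⟨e⟩`. -/
theorem quadratic_quotient_generator {K : Type*} [Field K] [CharZero K]
    (e : RatFunc K ≃ₐ[K] RatFunc K) (he2 : e.trans e = AlgEquiv.refl)
    (hne : e ≠ AlgEquiv.refl) :
    (RatFunc.X * e RatFunc.X ∉ Set.range (algebraMap K (RatFunc K)) ∨
      RatFunc.X + e RatFunc.X ∉ Set.range (algebraMap K (RatFunc K))) ∧
    ∀ lam : RatFunc K,
      ((RatFunc.X * e RatFunc.X ∉ Set.range (algebraMap K (RatFunc K)) →
          lam = RatFunc.X * e RatFunc.X) ∧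
        (RatFunc.X * e RatFunc.X ∈ Set.range (algebraMap K (RatFunc K)) →
          lam = RatFunc.X + e RatFunc.X)) →
      e lam = lam ∧
      Module.finrank (IntermediateField.adjoin K {lam}) (RatFunc K) = 2 ∧
      IntermediateField.adjoin K {lam} =
        IntermediateField.fixedField (Subgroup.zpowers e) := by
  refine ⟨RatFunc.X_mul_or_X_add_notMem_range _, fun lam ⟨hmul, hadd⟩ ↦ ?_⟩
  have hinv : e (e RatFunc.X) = RatFunc.X := DFunLike.congr_fun he2 RatFunc.X
  have hX : Module.finrank (IntermediateField.adjoin K {(RatFunc.X : RatFunc K)})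
      (RatFunc K) = 1 := by
    rw [IntermediateField.finrank_eq_one_iff_eq_top, RatFunc.adjoin_X]
  have heX : Module.finrank (IntermediateField.adjoin K {e RatFunc.X}) (RatFunc K) = 1 := by
    rw [IntermediateField.finrank_eq_one_iff_eq_top, RatFunc.adjoin_algEquiv_X]
  by_cases h : RatFunc.X * e RatFunc.X ∈ Set.range (algebraMap K (RatFunc K))
  · obtain rfl := hadd h
    have hfix : e (RatFunc.X + e RatFunc.X) = RatFunc.X + e RatFunc.X := by
      rw [map_add, hinv, add_comm]
    have hle := RatFunc.finrank_adjoin_add_le RatFunc.X (e RatFunc.X)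
    rw [hX, heX] at hle
    exact ⟨hfix, RatFunc.adjoin_eq_fixedField_of_finrank_le_two hne
      ((RatFunc.X_mul_or_X_add_notMem_range _).resolve_left (not_not_intro h)) hfix hle⟩
  · obtain rfl := hmul h
    have hfix : e (RatFunc.X * e RatFunc.X) = RatFunc.X * e RatFunc.X := by
      rw [map_mul, hinv, mul_comm]
    have hle := RatFunc.finrank_adjoin_mul_le RatFunc.X (e RatFunc.X)
    rw [hX, heX] at hle
    exact ⟨hfix, RatFunc.adjoin_eq_fixedField_of_finrank_le_two hne h hfix hle⟩
end

section
/- Let K be a field with char K ≠ 2, let A ∈ K be a non-square, let L be a quadratic extension of K containing an element s with s² = A, and let σ : L ≃ₐ[K] L be the nontrivial automorphism, so σ(s) = −s. Let B ∈ K with B ≠ 0. Regard RatFunc L as a K-algebra, and suppose τ : RatFunc L ≃ₐ[K] RatFunc L is a K-algebra automorphism satisfying τ(c) = σ(c) for every constant c ∈ L and τ(X) = B/X. Set u = (X + B/X)/2 and v = (X − B/X)/(2·s) in RatFunc L. Then: (i) u² = A·v² + B; (ii) τ(u) = u and τ(v) = v; (iii) τ ∘ τ = id; and (iv) the fixed field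 of the subgroup generated by τ equals the intermediate field K⟮u, v⟯ of RatFunc L over K generated by u and v. -/
/-- A quadratic extension containing `s` with a conjugation `s ↦ -s` is spanned by `1, s`. -/
theorem exists_eq_add_mul_of_conj {K L : Type*} [Field K] [Field L] [Algebra K L]
    (h2 : (2 : L) ≠ 0) (hquad : Module.finrank K L = 2) {s : L} (hs : s ≠ 0)
    (σ : L ≃ₐ[K] L) (hσ : σ s = -s) (c : L) :
    ∃ p q : K, c = algebraMap K L p + algebraMap K L q * s := by
  have hli : LinearIndependent K ![(1 : L), s] := by
    rw [LinearIndependent.pair_iff]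
    intro p q h
    rw [Algebra.smul_def, Algebra.smul_def, mul_one] at h
    have h' := congrArg σ h
    rw [map_add, map_mul, AlgEquiv.commutes, AlgEquiv.commutes, hσ, map_zero] at h'
    have hp : algebraMap K L p = 0 :=
      (mul_eq_zero_iff_left h2).mp (by linear_combination h + h')
    have hq : algebraMap K L q = 0 :=
      (mul_eq_zero_iff_right hs).mp (by linear_combination h - hp)
    exact ⟨(map_eq_zero _).mp hp, (map_eq_zero _).mp hq⟩
  have hspan := hli.span_eq_top_of_card_eq_finrank (by simp [hquad])
  have hc : c ∈ Submodule.span K (Set.range ![(1 : L), s]) := hspan ▸ Submodule.mem_top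
  rw [Matrix.range_cons, Matrix.range_cons, Matrix.range_empty, Set.union_empty,
    Set.singleton_union, Submodule.mem_span_pair] at hc
  obtain ⟨p, q, h⟩ := hc
  exact ⟨p, q, by rw [← h, Algebra.smul_def, Algebra.smul_def, mul_one]⟩

/-- If `t² ∈ E`, `E` is fixed by `τ` and `τ t = -t`, then `E + E t` is a subfield. -/
def Subfield.addMulOfConj {F : Type*} [Field F] (E : Subfield F) (t : F) (ht : t ^ 2 ∈ E)
    (τ : F →+* F) (hE : ∀ a ∈ E, τ a = a) (hτ : τ t = -t) : Subfield F where
  carrier := {f | ∃ a ∈ E, ∃ b ∈ E, f = a + b * t}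
  zero_mem' := ⟨0, E.zero_mem, 0, E.zero_mem, by ring⟩
  one_mem' := ⟨1, E.one_mem, 0, E.zero_mem, by ring⟩
  add_mem' := by
    rintro _ _ ⟨a, ha, b, hb, rfl⟩ ⟨c, hc, d, hd, rfl⟩
    exact ⟨a + c, E.add_mem ha hc, b + d, E.add_mem hb hd, by ring⟩
  neg_mem' := by
    rintro _ ⟨a, ha, b, hb, rfl⟩
    exact ⟨-a, E.neg_mem ha, -b, E.neg_mem hb, by ring⟩
  mul_mem' := by
    rintro _ _ ⟨a, ha, b, hb, rfl⟩ ⟨c, hc, d, hd, rfl⟩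
    exact ⟨a * c + b * d * t ^ 2,
      E.add_mem (E.mul_mem ha hc) (E.mul_mem (E.mul_mem hb hd) ht),
      a * d + b * c, E.add_mem (E.mul_mem ha hd) (E.mul_mem hb hc), by ring⟩
  inv_mem' := by
    rintro _ ⟨a, ha, b, hb, rfl⟩
    by_cases h : a + b * t = 0
    · exact ⟨0, E.zero_mem, 0, E.zero_mem, by simp [h]⟩
    have h' : a - b * t ≠ 0 := by
      have h'' := (map_ne_zero τ).mpr h
      rwa [map_add, map_mul, hE a ha, hE b hb, hτ, mul_neg, ← sub_eq_add_neg] at h''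
    have hN : a ^ 2 - b ^ 2 * t ^ 2 ∈ E :=
      E.sub_mem (E.pow_mem ha 2) (E.mul_mem (E.pow_mem hb 2) ht)
    have hN' : a ^ 2 - b ^ 2 * t ^ 2 = (a + b * t) * (a - b * t) := by ring
    refine ⟨a / (a ^ 2 - b ^ 2 * t ^ 2), E.div_mem ha hN,
      -b / (a ^ 2 - b ^ 2 * t ^ 2), E.div_mem (E.neg_mem hb) hN, ?_⟩
    rw [hN']
    field_simp
    ring

theorem RatFunc.mem_subfield_of_C_of_X {L : Type*} [Field L] (S : Subfield (RatFunc L))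
    (hC : ∀ c, RatFunc.C c ∈ S) (hX : RatFunc.X ∈ S) (f : RatFunc L) : f ∈ S := by
  have hp (p : Polynomial L) : algebraMap (Polynomial L) (RatFunc L) p ∈ S := by
    induction p using Polynomial.induction_on' with
    | add p q hp hq => rw [map_add]; exact S.add_mem hp hq
    | monomial n c =>
      rw [← Polynomial.C_mul_X_pow_eq_monomial, map_mul, map_pow, RatFunc.algebraMap_C,
        RatFunc.algebraMap_X]
      exact S.mul_mem (hC c) (S.pow_mem hX n)
  induction f using RatFunc.induction_on with
  | f p q hq => exact S.div_mem (hp p) (hp q)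

/-- Conic model lemma: for the automorphism `τ` of `RatFunc L` acting as the
quadratic conjugation `σ` on coefficients and as `X ↦ B/X`, the invariants
`u = (X + B/X)/2`, `v = (X − B/X)/(2s)` satisfy `u² = Av² + B`, are fixed by
`τ`, `τ` has order dividing 2, and the fixed field of `⟨τ⟩` is `K(u, v)`. -/
theorem conic_model_invariants {K L : Type*} [Field K] [Field L] [Algebra K L]
    (hchar : ringChar K ≠ 2) (A : K) (hA : ¬ IsSquare A)
    (hquad : Module.finrank K L = 2)
    (s : L) (hs : s ^ 2 = algebraMap K L A)
    (σ : L ≃ₐ[K] L) (hσ : σ s = -s)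
    (B : K) (hB : B ≠ 0)
    (τ : RatFunc L ≃ₐ[K] RatFunc L)
    (hτC : ∀ c : L, τ (RatFunc.C c) = RatFunc.C (σ c))
    (hτX : τ RatFunc.X = RatFunc.C (algebraMap K L B) / RatFunc.X)
    (u v : RatFunc L)
    (hu : u = (RatFunc.X + RatFunc.C (algebraMap K L B) / RatFunc.X) / 2)
    (hv : v = (RatFunc.X - RatFunc.C (algebraMap K L B) / RatFunc.X) /
      (2 * RatFunc.C s)) :
    u ^ 2 = RatFunc.C (algebraMap K L A) * v ^ 2 + RatFunc.C (algebraMap K L B) ∧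
    (τ u = u ∧ τ v = v) ∧
    τ.trans τ = AlgEquiv.refl ∧
    IntermediateField.fixedField (Subgroup.zpowers τ) =
      IntermediateField.adjoin K {u, v} := by
  have h2K : (2 : K) ≠ 0 := Ring.two_ne_zero hchar
  have h2L : (2 : L) ≠ 0 := by
    rw [← map_ofNat (algebraMap K L) 2]
    exact (map_ne_zero _).mpr h2K
  have h2 : (2 : RatFunc L) ≠ 0 := by
    rw [← map_ofNat (RatFunc.C (K := L)) 2]
    exact (map_ne_zero _).mpr h2L
  have hs0 : s ≠ 0 := by
    rintro rfl
    refine hA ⟨0, ?_⟩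
    rw [zero_pow two_ne_zero, eq_comm, map_eq_zero] at hs
    rw [hs, mul_zero]
  have ht0 : RatFunc.C s ≠ 0 := (map_ne_zero _).mpr hs0
  have hX0 : (RatFunc.X : RatFunc L) ≠ 0 := RatFunc.X_ne_zero
  have hB0 : RatFunc.C (algebraMap K L B) ≠ 0 := by simpa using hB
  have ht2 : RatFunc.C s ^ 2 = RatFunc.C (algebraMap K L A) := by rw [← map_pow, hs]
  have halg (k : K) : algebraMap K (RatFunc L) k = RatFunc.C (algebraMap K L k) := by
    rw [IsScalarTower.algebraMap_apply K L (RatFunc L), RatFunc.algebraMap_eq_C]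
  have hτt : τ (RatFunc.C s) = -RatFunc.C s := by rw [hτC, hσ, map_neg]
  have hτB : τ (RatFunc.C (algebraMap K L B)) = RatFunc.C (algebraMap K L B) := by
    rw [hτC, AlgEquiv.commutes]
  have hτu : τ u = u := by
    rw [hu, map_div₀, map_add, map_div₀, hτB, hτX, map_ofNat]
    field_simp
    ring
  have hτv : τ v = v := by
    rw [hv, map_div₀, map_sub, map_div₀, map_mul, hτB, hτX, hτt, map_ofNat]
    field_simp
    ring
  set E := IntermediateField.adjoin K {u, v} with hE
  have huE : u ∈ E := IntermediateField.subset_adjoin _ _ (by simp)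
  have hvE : v ∈ E := IntermediateField.subset_adjoin _ _ (by simp)
  have hle : E ≤ IntermediateField.fixedField (Subgroup.zpowers τ) := by
    have hfix (f : RatFunc L) (hf : τ f = f) :
        f ∈ IntermediateField.fixedField (Subgroup.zpowers τ) := by
      rw [IntermediateField.mem_fixedField_iff]
      intro g hg
      have hst : Subgroup.zpowers τ ≤ MulAction.stabilizer (RatFunc L ≃ₐ[K] RatFunc L) f :=
        Subgroup.zpowers_le.mpr hf
      exact hst hg
    rw [hE, IntermediateField.adjoin_le_iff, Set.insert_subset_iff, Set.singleton_subset_iff]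
    exact ⟨hfix u hτu, hfix v hτv⟩
  have hτE (a : RatFunc L) (ha : a ∈ E) : τ a = a :=
    (IntermediateField.mem_fixedField_iff _ _).mp (hle ha) τ (Subgroup.mem_zpowers τ)
  have hCE (k : K) : RatFunc.C (algebraMap K L k) ∈ E := halg k ▸ E.algebraMap_mem k
  have hdecomp (f : RatFunc L) : ∃ a ∈ E, ∃ b ∈ E, f = a + b * RatFunc.C s := by
    refine RatFunc.mem_subfield_of_C_of_X (E.toSubfield.addMulOfConj (RatFunc.C s)
      (ht2 ▸ hCE A) (τ : RatFunc L →+* RatFunc L) hτE hτt) (fun c => ?_) ?_ f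
    · obtain ⟨p, q, rfl⟩ := exists_eq_add_mul_of_conj h2L hquad hs0 σ hσ c
      exact ⟨_, hCE p, _, hCE q, by rw [map_add, map_mul]⟩
    · refine ⟨u, huE, v, hvE, ?_⟩
      rw [hu, hv]
      field_simp
      ring
  refine ⟨?_, ⟨hτu, hτv⟩, ?_, le_antisymm (fun f hf => ?_) hle⟩
  · rw [hu, hv, ← ht2]
    field_simp
    ring
  · ext f
    obtain ⟨a, ha, b, hb, rfl⟩ := hdecomp f
    simp [hτE a ha, hτE b hb, hτt]
  · have hτf := (IntermediateField.mem_fixedField_iff _ _).mp hf τ (Subgroup.mem_zpowers τ)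
    obtain ⟨a, ha, b, hb, rfl⟩ := hdecomp f
    rw [map_add, map_mul, hτE a ha, hτE b hb, hτt] at hτf
    have hbt : b * RatFunc.C s = 0 :=
      (mul_eq_zero_iff_left h2).mp (by linear_combination -hτf)
    rwa [hbt, add_zero]
end
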